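/- For every integer n ≥ 1, every integer k ≥ 0, and every x ∈ ℂ, one has (2/(2π i)) ∮_{|ξ|=1} (e^{x ξ}/ξ)^n · 1/((2k+1) π i (ξ − (2k+1) π i)) dξ = (−2/((2k+1) π i)^{n+1}) · S_{n-1}(n x (2k+1) π i). -/

import Mathlib

open scoped Real
open Complex

/-- `S m z` is the `m`-th partial sum of the exponential series. -/
noncomputable def S (m : ℕ) (z : ℂ) : ℂ := ∑ j ∈ Finset.range (m + 1), z ^ j / (Nat.factorial j : ℂ)

lemma circleIntegral_exp_mul_div_pow_succ (c : ℂ) (n : ℕ) :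
    (∮ ξ in C(0, 1), exp (c * ξ) / ξ ^ (n + 1)) = 2 * π * I * (c ^ n / n.factorial) := by
  have hd : Differentiable ℂ fun ξ : ℂ => exp (c * ξ) := by fun_prop
  have h := (hd.diffContOnCl (s := Metric.ball 0 1)).circleIntegral_one_div_sub_center_pow_smul
    one_pos n
  rw [iteratedDeriv_cexp_const_mul] at h
  simp only [sub_zero, smul_eq_mul, mul_zero, exp_zero, mul_one, one_div_mul_eq_div] at h
  rw [h]
  ring

lemma circleIntegral_exp_mul_div_pow_mul_sub (a c : ℂ) (ha : 1 < ‖a‖) (n : ℕ) :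
    (∮ ξ in C(0, 1), exp (c * ξ) / (ξ ^ n * (ξ - a))) =
      -(2 * π * I) / a ^ n * ∑ j ∈ Finset.range n, (c * a) ^ j / (j.factorial : ℂ) := by
  have ha0 : a ≠ 0 := norm_pos_iff.mp (one_pos.trans ha)
  have hsub : ∀ ξ ∈ Metric.closedBall (0 : ℂ) 1, ξ - a ≠ 0 := by
    rintro ξ hξ h
    rw [sub_eq_zero.mp h, mem_closedBall_zero_iff] at hξ
    exact absurd hξ ha.not_ge
  have hsphere : ∀ ξ ∈ Metric.sphere (0 : ℂ) 1, ξ ≠ 0 ∧ ξ - a ≠ 0 := fun ξ hξ =>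
    ⟨Metric.ne_of_mem_sphere hξ one_ne_zero, hsub ξ (Metric.sphere_subset_closedBall hξ)⟩
  induction n with
  | zero =>
    simp only [pow_zero, one_mul, Finset.range_zero, Finset.sum_empty, mul_zero]
    refine DiffContOnCl.circleIntegral_eq_zero zero_le_one
      (DifferentiableOn.diffContOnCl_ball (U := Metric.closedBall 0 1) ?_ subset_rfl)
    exact DifferentiableOn.div (by fun_prop) (by fun_prop) hsub
  | succ n ih =>
    have hsplit : Set.EqOn (fun ξ => exp (c * ξ) / (ξ ^ (n + 1) * (ξ - a)))
        (fun ξ => a⁻¹ * (exp (c * ξ) / (ξ ^ n * (ξ - a)) - exp (c * ξ) / ξ ^ (n + 1)))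
        (Metric.sphere 0 1) := by
      intro ξ hξ
      obtain ⟨h0, h1⟩ := hsphere ξ hξ
      field_simp
      ring
    have hint₁ : CircleIntegrable (fun ξ => exp (c * ξ) / (ξ ^ n * (ξ - a))) 0 1 :=
      ContinuousOn.circleIntegrable zero_le_one <| ContinuousOn.div (by fun_prop) (by fun_prop)
        fun ξ hξ => mul_ne_zero (pow_ne_zero _ (hsphere ξ hξ).1) (hsphere ξ hξ).2
    have hint₂ : CircleIntegrable (fun ξ => exp (c * ξ) / ξ ^ (n + 1)) 0 1 :=
      ContinuousOn.circleIntegrable zero_le_one <| ContinuousOn.div (by fun_prop) (by fun_prop)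
        fun ξ hξ => pow_ne_zero _ (hsphere ξ hξ).1
    rw [circleIntegral.integral_congr zero_le_one hsplit, circleIntegral.integral_const_mul,
      circleIntegral.integral_sub hint₁ hint₂, ih, circleIntegral_exp_mul_div_pow_succ,
      Finset.sum_range_succ, mul_pow]
    have hfac : (n.factorial : ℂ) ≠ 0 := Nat.cast_ne_zero.mpr n.factorial_ne_zero
    field_simp
    ring

lemma one_lt_norm_odd_mul_pi_mul_I (k : ℕ) : 1 < ‖(2 * (k : ℂ) + 1) * π * I‖ := by
  have hk : ‖2 * (k : ℂ) + 1‖ = 2 * k + 1 := by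
    exact_mod_cast Complex.norm_natCast (2 * k + 1)
  rw [norm_mul, norm_mul, hk, norm_I, norm_real, Real.norm_of_nonneg Real.pi_pos.le]
  nlinarith [Real.pi_gt_three, (Nat.cast_nonneg k : (0 : ℝ) ≤ k)]

theorem contour_integral_partial_sum (n : ℕ) (hn : 1 ≤ n) (k : ℕ) (x : ℂ) :
    (2 / (2 * π * Complex.I)) *
        (∮ ξ in C(0, 1), (Complex.exp (x * ξ) / ξ) ^ n *
          (1 / ((2 * (k : ℂ) + 1) * π * Complex.I * (ξ - (2 * (k : ℂ) + 1) * π * Complex.I))))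
      = (-2 / ((2 * (k : ℂ) + 1) * π * Complex.I) ^ (n + 1)) *
          S (n - 1) ((n : ℂ) * x * (2 * (k : ℂ) + 1) * π * Complex.I) := by
  have ha := one_lt_norm_odd_mul_pi_mul_I k
  rw [mul_assoc ((n : ℂ) * x * _), mul_assoc ((n : ℂ) * x), ← mul_assoc (2 * (k : ℂ) + 1)]
  generalize (2 * (k : ℂ) + 1) * π * I = a at ha ⊢
  have ha0 : a ≠ 0 := norm_pos_iff.mp (one_pos.trans ha)
  have hfun : (fun ξ : ℂ => (exp (x * ξ) / ξ) ^ n * (1 / (a * (ξ - a)))) =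
      fun ξ => a⁻¹ * (exp (n * x * ξ) / (ξ ^ n * (ξ - a))) := by
    ext ξ
    rw [div_pow, ← exp_nat_mul, ← mul_assoc (n : ℂ), div_mul_div_comm, mul_one, mul_left_comm,
      inv_mul_eq_div, div_div, mul_comm a]
  rw [hfun, circleIntegral.integral_const_mul, circleIntegral_exp_mul_div_pow_mul_sub a _ ha, S,
    Nat.sub_add_cancel hn]
  have hpi : (2 * π * I : ℂ) ≠ 0 := two_pi_I_ne_zero
  generalize ∑ j ∈ Finset.range n, (n * x * a) ^ j / (j.factorial : ℂ) = s
  generalize (2 * π * I : ℂ) = p at hpi ⊢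
  field_simp
  ring
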